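/- Let k ≥ 2 be even. Let A_{I₂(k)} be the Artin group of type I₂(k), presented by generators s₁, s₂ with the relation s₁s₂s₁s₂⋯ = s₂s₁s₂s₁⋯ (alternating products with k factors on each side), let W_{I₂(k)} be the dihedral group of order 2k, and let π_S : A_{I₂(k)} → W_{I₂(k)} be the canonical surjection. Then there exist a group homomorphism f : A_{I₂(k)} → B_{2k} with f(s₁) = σ₁σ₃σ₅⋯σ_{2k−1}, and an injective homomorphism e : W_{I₂(k)} → S_{2k} with e(s₁) = (1 2)(3 4)⋯(2k−1, 2k) and e(s₂) = (1 3)(2 5)(4 7)(6 9)⋯(2k−4, 2k−1)(2k−2, 2k), such that π_{2k} ∘ f = e ∘ π_S. -/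

import Mathlib

/-!
Braid group infrastructure.

`BraidGroup m` is the Artin braid group on `m` strands, presented with generators
`σ 0, …, σ (m-2)` (here `σ i` denotes the usual generator `σ_{i+1}`) and the braid
relations `σ i * σ j = σ j * σ i` for `|i - j| ≥ 2` and
`σ i * σ j * σ i = σ j * σ i * σ j` for `j = i + 1`.
-/

/-- The braid relations on `m` strands (generators indexed by `Fin (m - 1)`). -/
def braidRels (m : ℕ) : Set (FreeGroup (Fin (m - 1))) :=
  { r | (∃ i j : Fin (m - 1), (i : ℕ) + 2 ≤ (j : ℕ) ∧
          r = FreeGroup.of i * FreeGroup.of j * (FreeGroup.of i)⁻¹ * (FreeGroup.of j)⁻¹) ∨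
        (∃ i j : Fin (m - 1), (j : ℕ) = (i : ℕ) + 1 ∧
          r = FreeGroup.of i * FreeGroup.of j * FreeGroup.of i *
              (FreeGroup.of j * FreeGroup.of i * FreeGroup.of j)⁻¹) }

/-- The braid group on `m` strands. -/
abbrev BraidGroup (m : ℕ) : Type := PresentedGroup (braidRels m)

/-- The braid generator `σ_{i+1}` of the braid group on `m` strands. -/
def σ {m : ℕ} (i : Fin (m - 1)) : BraidGroup m := PresentedGroup.of i

private lemma swap_commute {α : Type*} [DecidableEq α] {a b c d : α}
    (hac : a ≠ c) (had : a ≠ d) (hbc : b ≠ c) (hbd : b ≠ d) :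
    Equiv.swap a b * Equiv.swap c d = Equiv.swap c d * Equiv.swap a b := by
  have h := (Equiv.swap_apply_apply (Equiv.swap a b) c d).symm
  rw [Equiv.swap_apply_of_ne_of_ne hac.symm hbc.symm,
    Equiv.swap_apply_of_ne_of_ne had.symm hbd.symm] at h
  exact mul_inv_eq_iff_eq_mul.mp h

private lemma swap_braid {α : Type*} [DecidableEq α] {x y z : α}
    (hxy : x ≠ y) (hyz : y ≠ z) (hxz : x ≠ z) :
    Equiv.swap x y * Equiv.swap y z * Equiv.swap x y =
      Equiv.swap y z * Equiv.swap x y * Equiv.swap y z := by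
  have h1 := (Equiv.swap_apply_apply (Equiv.swap x y) y z).symm
  rw [Equiv.swap_apply_right, Equiv.swap_apply_of_ne_of_ne hxz.symm hyz.symm] at h1
  have h2 := (Equiv.swap_apply_apply (Equiv.swap y z) x y).symm
  rw [Equiv.swap_apply_of_ne_of_ne hxy hxz, Equiv.swap_apply_left] at h2
  rw [Equiv.swap_inv] at h1 h2
  calc Equiv.swap x y * Equiv.swap y z * Equiv.swap x y = Equiv.swap x z := h1
    _ = Equiv.swap y z * Equiv.swap x y * Equiv.swap y z := h2.symm

/-- The transposition `(i+1, i+2)`, as image of the braid generator `σ_{i+1}`. -/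
def braidGen (m : ℕ) (i : Fin (m - 1)) : Equiv.Perm (Fin m) :=
  Equiv.swap ⟨i.1, by have := i.isLt; omega⟩ ⟨i.1 + 1, by have := i.isLt; omega⟩

private lemma braid_rels_hold (m : ℕ) :
    ∀ r ∈ braidRels m, FreeGroup.lift (braidGen m) r = 1 := by
  rintro r (⟨i, j, hij, rfl⟩ | ⟨i, j, hij, rfl⟩) <;>
    simp only [map_mul, map_inv, FreeGroup.lift_apply_of]
  · rw [mul_inv_eq_one (a := _ * _ * _), mul_inv_eq_iff_eq_mul]
    unfold braidGen
    apply swap_commute <;> (simp only [ne_eq, Fin.mk.injEq]; omega)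
  · obtain ⟨jv, hjlt⟩ := j
    simp only [Fin.val_mk] at hij
    subst hij
    rw [mul_inv_eq_one (a := _ * _ * _)]
    unfold braidGen
    simp only [Fin.val_mk]
    apply swap_braid <;> (simp only [ne_eq, Fin.mk.injEq]; omega)

/-- The canonical surjection from the braid group on `m` strands to the symmetric
group on `m` letters, sending `σ_{i+1}` to the transposition `(i+1, i+2)`
(`0`-indexed: the swap of `i` and `i + 1` in `Fin m`). -/
def braidToPerm (m : ℕ) : BraidGroup m →* Equiv.Perm (Fin m) :=
  PresentedGroup.toGroup (braid_rels_hold m)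
/-- `altProd x y n` is the alternating product `x * y * x * y * ⋯` with `n` factors. -/
def altProd {G : Type*} [Monoid G] (x y : G) : ℕ → G
  | 0 => 1
  | n + 1 => x * altProd y x n

lemma altProd_add_two {G : Type*} [Monoid G] (x y : G) (n : ℕ) :
    altProd x y (n + 2) = x * y * altProd x y n := by
  simp [altProd, mul_assoc]

lemma altProd_two_mul {G : Type*} [Monoid G] (x y : G) (n : ℕ) :
    altProd x y (2 * n) = (x * y) ^ n := by
  induction n with
  | zero => simp [altProd]
  | succ m ih =>
    rw [show 2 * (m + 1) = 2 * m + 2 from by ring, altProd_add_two, ih, ← pow_succ']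

lemma altProd_two_mul_add_one {G : Type*} [Monoid G] (x y : G) (n : ℕ) :
    altProd x y (2 * n + 1) = (x * y) ^ n * x := by
  induction n with
  | zero => simp [altProd]
  | succ m ih =>
    rw [show 2 * (m + 1) + 1 = (2 * m + 1) + 2 from by ring, altProd_add_two, ih,
      ← mul_assoc, ← pow_succ']

/-- In a group, if `s` and `t` are involutions and `(s * t) ^ k = 1`, then the two
alternating products of `s` and `t` with `k` factors agree. -/
lemma altProd_swap_eq {G : Type*} [Group G] {s t : G} (hs : s * s = 1) (ht : t * t = 1)
    {k : ℕ} (h : (s * t) ^ k = 1) : altProd s t k = altProd t s k := by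
  have hs' : s⁻¹ = s := inv_eq_of_mul_eq_one_right hs
  have ht' : t⁻¹ = t := inv_eq_of_mul_eq_one_right ht
  have hts : t * s = (s * t)⁻¹ := by rw [mul_inv_rev, hs', ht']
  rcases Nat.even_or_odd k with ⟨m, hm⟩ | ⟨m, hm⟩
  · obtain rfl : k = 2 * m := by omega
    rw [altProd_two_mul, altProd_two_mul, hts, inv_pow]
    rw [show 2 * m = m + m from by ring, pow_add] at h
    exact (inv_eq_of_mul_eq_one_right h).symm
  · obtain rfl : k = 2 * m + 1 := by omega
    rw [altProd_two_mul_add_one, altProd_two_mul_add_one, hts, inv_pow]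
    rw [show 2 * m + 1 = m + (m + 1) from by ring, pow_add, pow_succ] at h
    rw [inv_eq_of_mul_eq_one_right h, mul_assoc, mul_assoc, ht, mul_one]

lemma map_altProd {G H : Type*} [Monoid G] [Monoid H] (φ : G →* H) (x y : G) (n : ℕ) :
    φ (altProd x y n) = altProd (φ x) (φ y) n := by
  induction n generalizing x y with
  | zero => simp [altProd]
  | succ m ih => simp [altProd, ih]
/-- The defining (Artin/braid) relation of the Artin group of type `I₂(k)`:
the two alternating products of the generators with `k` factors agree. -/
def I2Rels (k : ℕ) : Set (FreeGroup (Fin 2)) :=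
  { altProd (FreeGroup.of 0) (FreeGroup.of 1) k *
      (altProd (FreeGroup.of 1) (FreeGroup.of 0) k)⁻¹ }

/-- The Artin (generalized braid) group of type `I₂(k)`. -/
abbrev ArtinI2 (k : ℕ) : Type := PresentedGroup (I2Rels k)

/-- The first generator `s₁` of the Artin group of type `I₂(k)`. -/
def I2s₁ {k : ℕ} : ArtinI2 k := PresentedGroup.of 0

/-- The second generator `s₂` of the Artin group of type `I₂(k)`. -/
def I2s₂ {k : ℕ} : ArtinI2 k := PresentedGroup.of 1

/-- The canonical surjection from the Artin group of type `I₂(k)` onto the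
associated Coxeter group, the dihedral group of order `2k` (adding the relations
`s₁² = s₂² = 1`); it sends `s₁ ↦ sr 0` and `s₂ ↦ sr 1`. -/
def artinI2ToDihedral (k : ℕ) : ArtinI2 k →* DihedralGroup k :=
  PresentedGroup.toGroup (f := ![DihedralGroup.sr 0, DihedralGroup.sr 1])
    (by
      intro r hr
      simp only [I2Rels, Set.mem_singleton_iff] at hr
      subst hr
      rw [map_mul, map_inv, mul_inv_eq_one, map_altProd, map_altProd,
        FreeGroup.lift_apply_of, FreeGroup.lift_apply_of]
      simp only [Matrix.cons_val_zero, Matrix.cons_val_one, Matrix.head_cons]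
      refine altProd_swap_eq (DihedralGroup.sr_mul_self 0) (DihedralGroup.sr_mul_self 1) ?_
      rw [DihedralGroup.sr_mul_sr, sub_zero, DihedralGroup.r_one_pow_n])

section OddEvenRows

variable {G : Type*}

/-- The product `g l * g (l + 2) * ⋯ * g (l + 2 * (s - 1))`. -/
def stepTwoProd [Monoid G] (g : ℕ → G) (l s : ℕ) : G :=
  ((List.range s).map fun i => g (l + 2 * i)).prod

/-- The product `g l * g (l + 1) * ⋯ * g (l + s - 1)`. -/
def stepOneProd [Monoid G] (g : ℕ → G) (l s : ℕ) : G :=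
  ((List.range s).map fun i => g (l + i)).prod

/-- The sequence `g` satisfies the braid relations on `g 0, …, g (n - 1)` and is trivial
from `n` on. -/
structure IsBraidSeq [Monoid G] (g : ℕ → G) (n : ℕ) : Prop where
  commute : ∀ i j, i + 2 ≤ j → Commute (g i) (g j)
  braid : ∀ i, i + 1 < n → g i * g (i + 1) * g i = g (i + 1) * g i * g (i + 1)
  eq_one : ∀ j, n ≤ j → g j = 1

lemma stepTwoProd_succ [Monoid G] (g : ℕ → G) (l s : ℕ) :
    stepTwoProd g l (s + 1) = stepTwoProd g l s * g (l + 2 * s) := by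
  simp [stepTwoProd, List.range_succ]

lemma stepOneProd_succ [Monoid G] (g : ℕ → G) (l s : ℕ) :
    stepOneProd g l (s + 1) = stepOneProd g l s * g (l + s) := by
  simp [stepOneProd, List.range_succ]

lemma stepTwoProd_add [Monoid G] (g : ℕ → G) (l s t : ℕ) :
    stepTwoProd g l (s + t) = stepTwoProd g l s * stepTwoProd g (l + 2 * s) t := by
  induction t with
  | zero => simp [stepTwoProd]
  | succ t ih =>
    rw [← add_assoc, stepTwoProd_succ, ih, stepTwoProd_succ, mul_assoc,
      show l + 2 * s + 2 * t = l + 2 * (s + t) by ring]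

lemma commute_stepTwoProd [Monoid G] {g : ℕ → G} {x : G} {l s : ℕ}
    (h : ∀ i < s, Commute x (g (l + 2 * i))) : Commute x (stepTwoProd g l s) := by
  refine Commute.list_prod_right _ _ fun y hy => ?_
  obtain ⟨i, hi, rfl⟩ := List.mem_map.1 hy
  exact h i (List.mem_range.1 hi)

lemma commute_stepOneProd [Monoid G] {g : ℕ → G} {x : G} {l s : ℕ}
    (h : ∀ i < s, Commute x (g (l + i))) : Commute x (stepOneProd g l s) := by
  refine Commute.list_prod_right _ _ fun y hy => ?_
  obtain ⟨i, hi, rfl⟩ := List.mem_map.1 hy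
  exact h i (List.mem_range.1 hi)

lemma altProd_succ_right [Monoid G] (x y : G) (t : ℕ) :
    altProd x y (t + 1) = altProd x y t * if Even t then x else y := by
  induction t generalizing x y with
  | zero => simp [altProd]
  | succ t ih =>
    rw [altProd, ih, altProd, mul_assoc]
    simp only [Nat.even_add_one, ite_not]

namespace IsBraidSeq

variable [Monoid G] {g : ℕ → G} {n : ℕ}

lemma stepTwoProd_eq_one (hg : IsBraidSeq g n) {l : ℕ} (hl : n ≤ l) (s : ℕ) :
    stepTwoProd g l s = 1 := by
  refine List.prod_eq_one fun y hy => ?_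
  obtain ⟨i, -, rfl⟩ := List.mem_map.1 hy
  exact hg.eq_one _ (by omega)

lemma stepTwoProd_congr (hg : IsBraidSeq g n) {l s t : ℕ} (hs : n ≤ l + 2 * s)
    (ht : n ≤ l + 2 * t) : stepTwoProd g l s = stepTwoProd g l t := by
  rcases le_total s t with h | h
  · obtain ⟨d, rfl⟩ := Nat.exists_eq_add_of_le h
    rw [stepTwoProd_add, hg.stepTwoProd_eq_one hs, mul_one]
  · obtain ⟨d, rfl⟩ := Nat.exists_eq_add_of_le h
    rw [stepTwoProd_add, hg.stepTwoProd_eq_one ht, mul_one]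

lemma stepTwoProd_split (hg : IsBraidSeq g n) (l s : ℕ) :
    stepTwoProd g l n = stepTwoProd g l s * stepTwoProd g (l + 2 * s) n := by
  rw [← stepTwoProd_add]
  exact hg.stepTwoProd_congr (by omega) (by omega)

lemma stepOneProd_mul_gen (hg : IsBraidSeq g n) {l i s : ℕ} (hi : i + 1 < s)
    (hs : l + i + 1 < n) :
    stepOneProd g l s * g (l + i) = g (l + i + 1) * stepOneProd g l s := by
  induction s with
  | zero => omega
  | succ s ih =>
    rw [stepOneProd_succ]
    rcases Nat.lt_or_ge (i + 1) s with h | h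
    · rw [mul_assoc, ← (hg.commute (l + i) (l + s) (by omega)).eq, ← mul_assoc, ih h, mul_assoc]
    · obtain rfl : s = i + 1 := by omega
      have hc : Commute (g (l + i + 1)) (stepOneProd g l i) :=
        commute_stepOneProd fun j hj => (hg.commute _ _ (by omega)).symm
      have hb := hg.braid (l + i) hs
      rw [stepOneProd_succ, ← add_assoc]
      calc stepOneProd g l i * g (l + i) * g (l + i + 1) * g (l + i)
          = stepOneProd g l i * (g (l + i) * g (l + i + 1) * g (l + i)) := by
            simp only [mul_assoc]
        _ = stepOneProd g l i * g (l + i + 1) * (g (l + i) * g (l + i + 1)) := by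
            rw [hb]; simp only [mul_assoc]
        _ = g (l + i + 1) * (stepOneProd g l i * g (l + i) * g (l + i + 1)) := by
            rw [← hc.eq]; simp only [mul_assoc]

lemma stepOneProd_mul_stepTwoProd (hg : IsBraidSeq g n) {l q r s : ℕ} (hq : l ≤ q)
    (hs : q + 2 * s ≤ l + r) (hn : l + r ≤ n) :
    stepOneProd g l r * stepTwoProd g q s = stepTwoProd g (q + 1) s * stepOneProd g l r := by
  induction s with
  | zero => simp [stepTwoProd]
  | succ s ih =>
    obtain ⟨d, rfl⟩ := Nat.exists_eq_add_of_le hq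
    have h := hg.stepOneProd_mul_gen (l := l) (i := d + 2 * s) (s := r) (by omega) (by omega)
    rw [stepTwoProd_succ, stepTwoProd_succ, ← mul_assoc, ih (by omega), mul_assoc,
      show l + d + 2 * s = l + (d + 2 * s) by ring, h, ← mul_assoc,
      show l + (d + 2 * s) + 1 = l + d + 1 + 2 * s by ring]

/-- Pushing one more row of commuting generators past the staircase `g l * ⋯ * g (l + t)`. -/
lemma staircase_mul_row (hg : IsBraidSeq g n) {l q s t : ℕ} (hq : l ≤ q)
    (hs : q + 2 * s = l + t + 1) (hn : l + t + 1 ≤ n) :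
    stepOneProd g l (t + 1) * stepTwoProd g (l + t + 2) n * stepTwoProd g q n =
      stepTwoProd g (q + 1) n * (stepOneProd g l (t + 2) * stepTwoProd g (l + t + 3) n) := by
  have h₁ : Commute (stepTwoProd g (l + t + 2) n) (stepTwoProd g q s) :=
    commute_stepTwoProd fun i hi => (commute_stepTwoProd fun j _ =>
      hg.commute _ _ (by omega)).symm
  have h₂ : Commute (stepTwoProd g (l + t + 2) n) (stepOneProd g l (t + 1)) :=
    commute_stepOneProd fun i hi => (commute_stepTwoProd fun j _ =>
      hg.commute _ _ (by omega)).symm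
  have h₃ := hg.stepOneProd_mul_stepTwoProd (r := t + 1) (s := s) hq (by omega) (by omega)
  have h₄ : stepTwoProd g (q + 2 * s) n = g (l + t + 1) * stepTwoProd g (l + t + 3) n := by
    rw [hs, hg.stepTwoProd_split _ 1]
    simp [stepTwoProd]
  rw [hg.stepTwoProd_split q s, hg.stepTwoProd_split (q + 1) s, h₄,
    show q + 1 + 2 * s = l + t + 2 by omega, stepOneProd_succ g l (t + 1), ← add_assoc l t 1]
  calc stepOneProd g l (t + 1) * stepTwoProd g (l + t + 2) n *
        (stepTwoProd g q s * (g (l + t + 1) * stepTwoProd g (l + t + 3) n))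
      = stepOneProd g l (t + 1) * (stepTwoProd g (l + t + 2) n * stepTwoProd g q s) *
        (g (l + t + 1) * stepTwoProd g (l + t + 3) n) := by simp only [mul_assoc]
    _ = (stepOneProd g l (t + 1) * stepTwoProd g q s) * stepTwoProd g (l + t + 2) n *
        (g (l + t + 1) * stepTwoProd g (l + t + 3) n) := by rw [h₁.eq]; simp only [mul_assoc]
    _ = stepTwoProd g (q + 1) s * (stepOneProd g l (t + 1) * stepTwoProd g (l + t + 2) n) *
        (g (l + t + 1) * stepTwoProd g (l + t + 3) n) := by rw [h₃]; simp only [mul_assoc]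
    _ = _ := by rw [← h₂.eq]; simp only [mul_assoc]

lemma altProd_rows_eq (hg : IsBraidSeq g n) {l t : ℕ} (h : l + t ≤ n) :
    altProd (stepTwoProd g l n) (stepTwoProd g (l + 1) n) (t + 1) =
      altProd (stepTwoProd g (l + 2) n) (stepTwoProd g (l + 1) n) t *
        (stepOneProd g l (t + 1) * stepTwoProd g (l + t + 2) n) := by
  induction t with
  | zero =>
    rw [hg.stepTwoProd_split l 1]
    simp [altProd, stepTwoProd, stepOneProd]
  | succ t ih =>
    rw [altProd_succ_right, ih (by omega), altProd_succ_right _ _ t,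
      mul_assoc (altProd _ _ t), mul_assoc (altProd _ _ t)]
    congr 1
    rcases Nat.even_or_odd' t with ⟨s, rfl | rfl⟩
    · simpa [Nat.even_add_one, ← add_assoc, parity_simps] using
        hg.staircase_mul_row (l := l) (q := l + 1) (s := s) (t := 2 * s) (by omega) (by omega)
          (by omega)
    · simpa [Nat.even_add_one, ← add_assoc, parity_simps] using
        hg.staircase_mul_row (l := l) (q := l) (s := s + 1) (t := 2 * s + 1) (by omega)
          (by omega) (by omega)

/-- The products of the odd and of the even generators of a braid group satisfy the
dihedral Artin relation whose length is the number of strands. -/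
theorem altProd_rows_comm (hg : IsBraidSeq g n) {l N : ℕ} (h : l + N = n) :
    altProd (stepTwoProd g l n) (stepTwoProd g (l + 1) n) (N + 1) =
      altProd (stepTwoProd g (l + 1) n) (stepTwoProd g l n) (N + 1) := by
  induction N generalizing l with
  | zero => simp [altProd, hg.stepTwoProd_eq_one (show n ≤ l by omega),
      hg.stepTwoProd_eq_one (show n ≤ l + 1 by omega)]
  | succ N ih =>
    have hl : altProd (stepTwoProd g (l + 1) n) (stepTwoProd g l n) (N + 1 + 1) =
        stepTwoProd g (l + 1) n *
          altProd (stepTwoProd g l n) (stepTwoProd g (l + 1) n) (N + 1) := rfl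
    rw [hl, hg.altProd_rows_eq (show l + N ≤ n by omega),
      hg.altProd_rows_eq (show l + (N + 1) ≤ n by omega), ← ih (l := l + 1) (by omega),
      stepOneProd_succ g l (N + 1), hg.eq_one (l + (N + 1)) (by omega),
      hg.stepTwoProd_eq_one (show n ≤ l + N + 2 by omega),
      hg.stepTwoProd_eq_one (show n ≤ l + (N + 1) + 2 by omega), altProd]
    simp only [mul_one, mul_assoc]

end IsBraidSeq

end OddEvenRows

section Dihedral

variable {G : Type*} [Group G]

/-- The homomorphism from a dihedral group determined by two involutions `a` and `b`
with `(a * b) ^ k = 1`, sending `sr 0` to `a` and `sr 1` to `b`. -/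
def dihedralLift {k : ℕ} (a b : G) (ha : a * a = 1) (hb : b * b = 1) (h : (a * b) ^ k = 1) :
    DihedralGroup k →* G :=
  let ρ : ZMod k →+ Additive G := ZMod.lift k ⟨zmultiplesHom _ (Additive.ofMul (a * b)), by
    rw [zmultiplesHom_apply, natCast_zsmul, ← ofMul_pow, h, ofMul_one]⟩
  have hρ : ∀ i, (ρ i).toMul * a = a * (ρ (-i)).toMul := by
    intro i
    obtain ⟨n, rfl⟩ := ZMod.intCast_surjective i
    have hconj : SemiconjBy a (a * b)⁻¹ (a * b) := by
      have ha' : a⁻¹ = a := inv_eq_of_mul_eq_one_right ha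
      have hb' : b⁻¹ = b := inv_eq_of_mul_eq_one_right hb
      simp [SemiconjBy, ha', hb', mul_assoc]
    have hn := (hconj.zpow_right n).eq
    rw [← Int.cast_neg, ZMod.lift_coe, ZMod.lift_coe]
    simpa [-mul_inv_rev] using hn.symm
  { toFun := fun x => match x with
      | .r i => (ρ i).toMul
      | .sr i => a * (ρ i).toMul
    map_one' := by simp [DihedralGroup.one_def, -DihedralGroup.r_zero]
    map_mul' := by
      rintro (i | i) (j | j)
      · simp
      · simp [← mul_assoc, hρ, sub_eq_neg_add]
      · simp [mul_assoc]
      · simp only [DihedralGroup.sr_mul_sr, sub_eq_neg_add, map_add, toMul_add]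
        rw [mul_assoc, ← mul_assoc _ a, hρ, mul_assoc, ← mul_assoc a a, ha, one_mul] }

variable {k : ℕ} {a b : G} {ha : a * a = 1} {hb : b * b = 1} {h : (a * b) ^ k = 1}

lemma dihedralLift_sr_zero : dihedralLift a b ha hb h (.sr 0) = a := by
  simp [dihedralLift]

lemma dihedralLift_r_natCast (n : ℕ) : dihedralLift a b ha hb h (.r n) = (a * b) ^ n := by
  have hn := ZMod.lift_coe k ⟨zmultiplesHom _ (Additive.ofMul (a * b)), by
    rw [zmultiplesHom_apply, natCast_zsmul, ← ofMul_pow, h, ofMul_one]⟩ n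
  simp only [Int.cast_natCast] at hn
  simp only [dihedralLift, MonoidHom.coe_mk, OneHom.coe_mk, hn]
  simp

lemma dihedralLift_sr_one : dihedralLift a b ha hb h (.sr 1) = b := by
  have hr := dihedralLift_r_natCast (ha := ha) (hb := hb) (h := h) 1
  rw [Nat.cast_one, pow_one, show (1 : ZMod k) = 1 - 0 by simp, ← DihedralGroup.sr_mul_sr,
    map_mul, dihedralLift_sr_zero] at hr
  exact mul_left_cancel hr

/-- A homomorphism from a dihedral group is injective if it is faithful on the rotations and
does not kill the reflections `sr 0` and `sr 1`. -/
lemma DihedralGroup.injective_of_ne_one [NeZero k] (e : DihedralGroup k →* G)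
    (h₀ : e (.sr 0) ≠ 1) (h₁ : e (.sr 1) ≠ 1)
    (hr : ∀ n : ℕ, 0 < n → n < k → e (.r n) ≠ 1) : Function.Injective e := by
  have hconj : ∀ (c : ZMod k) (i : ℕ), e (.sr (c + 2 * i)) = 1 → e (.sr c) = 1 := by
    intro c i hi
    have : (DihedralGroup.sr c) = .r (i : ZMod k) * .sr (c + 2 * i) * (.r (i : ZMod k))⁻¹ := by
      simp only [DihedralGroup.inv_r, DihedralGroup.r_mul_sr, DihedralGroup.sr_mul_r]
      congr 1
      ring
    rw [this, map_mul, map_mul, hi, mul_one, ← map_mul, mul_inv_cancel, map_one]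
  rw [injective_iff_map_eq_one]
  rintro (i | i) hi
  · rw [← ZMod.natCast_zmod_val i] at hi ⊢
    by_cases h : i.val = 0
    · simp [h]
    · exact absurd hi (hr _ (Nat.pos_of_ne_zero h) i.val_lt)
  · rw [← ZMod.natCast_zmod_val i] at hi
    rcases Nat.even_or_odd' i.val with ⟨m, hm | hm⟩
    · refine absurd (hconj 0 m ?_) h₀
      rw [hm] at hi
      simpa using hi
    · refine absurd (hconj 1 m ?_) h₁
      rw [hm] at hi
      simpa [add_comm] using hi

end Dihedral

section SwapProducts

variable {ι α : Type*} [DecidableEq α]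

lemma prod_swap_apply_of_ne (u v : ι → α) (L : List ι) {x : α}
    (hx : ∀ i ∈ L, x ≠ u i ∧ x ≠ v i) :
    (L.map fun i => Equiv.swap (u i) (v i)).prod x = x := by
  induction L with
  | nil => simp
  | cons a L ih =>
    rw [List.map_cons, List.prod_cons, Equiv.Perm.mul_apply,
      ih fun i hi => hx i (List.mem_cons_of_mem _ hi)]
    exact Equiv.swap_apply_of_ne_of_ne (hx a List.mem_cons_self).1 (hx a List.mem_cons_self).2

lemma prod_swap_apply_left {u v : ι → α} (hu : Function.Injective u)
    (hv : Function.Injective v) (huv : ∀ i j, u i ≠ v j) {L : List ι} (hL : L.Nodup)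
    {i : ι} (hi : i ∈ L) : (L.map fun i => Equiv.swap (u i) (v i)).prod (u i) = v i := by
  induction L with
  | nil => simp at hi
  | cons a L ih =>
    rw [List.nodup_cons] at hL
    rw [List.map_cons, List.prod_cons, Equiv.Perm.mul_apply]
    rcases List.mem_cons.1 hi with rfl | hi'
    · rw [prod_swap_apply_of_ne u v L fun j hj =>
        ⟨hu.ne fun h => hL.1 (by rwa [h]), huv i j⟩, Equiv.swap_apply_left]
    · rw [ih hL.2 hi']
      exact Equiv.swap_apply_of_ne_of_ne (huv a i).symm (hv.ne fun h => hL.1 (h ▸ hi'))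

lemma prod_swap_apply_right {u v : ι → α} (hu : Function.Injective u)
    (hv : Function.Injective v) (huv : ∀ i j, u i ≠ v j) {L : List ι} (hL : L.Nodup)
    {i : ι} (hi : i ∈ L) : (L.map fun i => Equiv.swap (u i) (v i)).prod (v i) = u i := by
  simp only [Equiv.swap_comm (u _) (v _)]
  exact prod_swap_apply_left hv hu (fun i j => (huv j i).symm) hL hi

/-- The action of a product of transpositions `(2 * i + c, 2 * i + c + d)` with `d` odd. -/
lemma prod_swap_apply_val {m N c d : ℕ} (hd : d % 2 = 1) (u v : Fin m → Fin N)
    (hu : ∀ i, (u i).val = 2 * i.val + c) (hv : ∀ i, (v i).val = 2 * i.val + c + d)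
    (x : Fin N) :
    (((List.finRange m).map fun i => Equiv.swap (u i) (v i)).prod x).val =
      if x.val % 2 = c % 2 ∧ c ≤ x.val ∧ x.val < 2 * m + c then x.val + d
      else if x.val % 2 = (c + d) % 2 ∧ c + d ≤ x.val ∧ x.val < 2 * m + c + d then x.val - d
      else x.val := by
  have hui : Function.Injective u := fun i j h => by
    have := congrArg Fin.val h
    rw [hu, hu] at this
    exact Fin.ext (by omega)
  have hvi : Function.Injective v := fun i j h => by
    have := congrArg Fin.val h
    rw [hv, hv] at this
    exact Fin.ext (by omega)
  have huv : ∀ i j, u i ≠ v j := fun i j h => by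
    have := congrArg Fin.val h
    rw [hu, hv] at this
    omega
  split_ifs with h₁ h₂
  · obtain ⟨i, rfl⟩ : ∃ i, x = u i :=
      ⟨⟨(x.val - c) / 2, by omega⟩, Fin.ext (by rw [hu]; simp only; omega)⟩
    rw [prod_swap_apply_left hui hvi huv (List.nodup_finRange m) (List.mem_finRange _), hu, hv]
  · obtain ⟨i, rfl⟩ : ∃ i, x = v i :=
      ⟨⟨(x.val - c - d) / 2, by omega⟩, Fin.ext (by rw [hv]; simp only; omega)⟩
    rw [prod_swap_apply_right hui hvi huv (List.nodup_finRange m) (List.mem_finRange _), hu, hv]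
    omega
  · rw [prod_swap_apply_of_ne]
    refine fun i _ => ⟨fun h => h₁ ?_, fun h => h₂ ?_⟩
    · rw [h, hu]
      omega
    · rw [h, hv]
      omega

lemma swap_apply_val {N : ℕ} (a b x : Fin N) :
    (Equiv.swap a b x).val =
      if x.val = a.val then b.val else if x.val = b.val then a.val else x.val := by
  rw [Equiv.swap_apply_def]
  simp only [Fin.ext_iff]
  split_ifs <;> rfl

end SwapProducts

section BraidSequence

/-- The braid generators on `m` strands as a sequence, extended by `1`. -/
def braidSeq (m i : ℕ) : BraidGroup m := if h : i < m - 1 then σ ⟨i, h⟩ else 1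

lemma braidSeq_of_lt {m i : ℕ} (h : i < m - 1) : braidSeq m i = σ ⟨i, h⟩ := dif_pos h

lemma isBraidSeq_braidSeq (m : ℕ) : IsBraidSeq (braidSeq m) (m - 1) where
  commute i j hij := by
    by_cases hj : j < m - 1
    · rw [braidSeq_of_lt hj, braidSeq_of_lt (show i < m - 1 by omega)]
      have h := PresentedGroup.one_of_mem (rels := braidRels m)
        (Or.inl ⟨⟨i, by omega⟩, ⟨j, hj⟩, hij, rfl⟩)
      simp only [map_mul, map_inv] at h
      rw [mul_inv_eq_one, mul_inv_eq_iff_eq_mul] at h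
      exact h
    · rw [braidSeq, braidSeq, dif_neg hj]
      exact Commute.one_right _
  braid i hi := by
    rw [braidSeq_of_lt hi, braidSeq_of_lt (show i < m - 1 by omega)]
    have h := PresentedGroup.one_of_mem (rels := braidRels m)
      (Or.inr ⟨⟨i, by omega⟩, ⟨i + 1, hi⟩, rfl, rfl⟩)
    rw [map_mul, map_inv, mul_inv_eq_one] at h
    simp only [map_mul] at h
    exact h
  eq_one j hj := dif_neg (by omega)

lemma stepTwoProd_braidSeq {m l s : ℕ} (h : l + 2 * s ≤ m) :
    stepTwoProd (braidSeq m) l s = ((List.finRange s).map fun i =>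
      σ (m := m) ⟨l + 2 * i.1, by have := i.isLt; omega⟩).prod := by
  rw [stepTwoProd, ← List.map_coe_finRange_eq_range, List.map_map]
  congr 2
  funext i
  exact braidSeq_of_lt (show l + 2 * i.val < m - 1 by have := i.isLt; omega)

lemma braidToPerm_σ {m : ℕ} (i : Fin (m - 1)) : braidToPerm m (σ i) = braidGen m i :=
  PresentedGroup.toGroup.of _

end BraidSequence

lemma altProd_mul_mul_comm {G : Type*} [Monoid G] {a c : G} {k : ℕ} (hk : k % 2 = 0)
    (h : altProd a c (2 * k) = altProd c a (2 * k)) :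
    altProd a (c * a * c) k = altProd (c * a * c) a k := by
  obtain ⟨m, rfl⟩ : ∃ m, k = 2 * m := ⟨k / 2, by omega⟩
  rw [altProd_two_mul, altProd_two_mul, pow_mul, pow_mul] at h
  rw [altProd_two_mul, altProd_two_mul]
  simpa only [sq, mul_assoc] using h

lemma mul_pow_eq_one_of_altProd_comm {G : Type*} [Group G] {s t : G} (hs : s * s = 1)
    (ht : t * t = 1) {k : ℕ} (hk : k % 2 = 0) (h : altProd s t k = altProd t s k) :
    (s * t) ^ k = 1 := by
  obtain ⟨m, rfl⟩ : ∃ m, k = 2 * m := ⟨k / 2, by omega⟩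
  have hinv : t * s = (s * t)⁻¹ := by
    rw [mul_inv_rev, inv_eq_of_mul_eq_one_right hs, inv_eq_of_mul_eq_one_right ht]
  rw [altProd_two_mul, altProd_two_mul, hinv, inv_pow] at h
  rw [two_mul, pow_add]
  exact mul_eq_one_iff_eq_inv.2 h

section Permutations

variable {k : ℕ}

/-- The permutation `(1 2)(3 4)⋯(2k-1, 2k)`. -/
def swapOdd (k : ℕ) : Equiv.Perm (Fin (2 * k)) :=
  ((List.finRange k).map fun i =>
    Equiv.swap (⟨2 * i.1, by have := i.isLt; omega⟩ : Fin (2 * k))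
      ⟨2 * i.1 + 1, by have := i.isLt; omega⟩).prod

/-- The permutation `(2 3)(4 5)⋯(2k-2, 2k-1)`. -/
def swapEven (k : ℕ) : Equiv.Perm (Fin (2 * k)) :=
  ((List.finRange (k - 1)).map fun i =>
    Equiv.swap (⟨1 + 2 * i.1, by have := i.isLt; omega⟩ : Fin (2 * k))
      ⟨1 + 2 * i.1 + 1, by have := i.isLt; omega⟩).prod

/-- The permutation `(1 3)(2 5)(4 7)⋯(2k-4, 2k-1)(2k-2, 2k)`. -/
def swapSkew (k : ℕ) (hk : 2 ≤ k) : Equiv.Perm (Fin (2 * k)) :=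
  Equiv.swap (⟨0, by omega⟩ : Fin (2 * k)) ⟨2, by omega⟩ *
    ((List.finRange (k - 2)).map fun i =>
      Equiv.swap (⟨2 * i.1 + 1, by have := i.isLt; omega⟩ : Fin (2 * k))
        ⟨2 * i.1 + 4, by have := i.isLt; omega⟩).prod *
    Equiv.swap (⟨2 * k - 3, by omega⟩ : Fin (2 * k)) ⟨2 * k - 1, by omega⟩

lemma swapOdd_apply_val (x : Fin (2 * k)) :
    (swapOdd k x).val = if x.val % 2 = 0 then x.val + 1 else x.val - 1 := by
  have h := prod_swap_apply_val (m := k) (c := 0) (d := 1) rfl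
    (fun i => (⟨2 * i.1, by have := i.isLt; omega⟩ : Fin (2 * k)))
    (fun i => ⟨2 * i.1 + 1, by have := i.isLt; omega⟩) (fun _ => rfl) (fun _ => rfl) x
  rw [swapOdd, h]
  split_ifs <;> first | contradiction | omega

lemma swapEven_apply_val (x : Fin (2 * k)) :
    (swapEven k x).val = if x.val = 0 then x.val else if x.val = 2 * k - 1 then x.val
      else if x.val % 2 = 0 then x.val - 1 else x.val + 1 := by
  have h := prod_swap_apply_val (m := k - 1) (c := 1) (d := 1) rfl
    (fun i => (⟨1 + 2 * i.1, by have := i.isLt; omega⟩ : Fin (2 * k)))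
    (fun i => ⟨1 + 2 * i.1 + 1, by have := i.isLt; omega⟩)
    (fun _ => add_comm _ _) (fun _ => by simp only; omega) x
  have hx := x.isLt
  rw [swapEven, h]
  split_ifs <;> first | contradiction | omega

lemma swapSkew_apply_val (hk : 2 ≤ k) (x : Fin (2 * k)) :
    (swapSkew k hk x).val = if x.val = 0 then 2 else if x.val = 2 then 0
      else if x.val = 2 * k - 3 then 2 * k - 1 else if x.val = 2 * k - 1 then 2 * k - 3
      else if x.val % 2 = 0 then x.val - 3 else x.val + 3 := by
  have h := prod_swap_apply_val (m := k - 2) (c := 1) (d := 3) rfl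
    (fun i => (⟨2 * i.1 + 1, by have := i.isLt; omega⟩ : Fin (2 * k)))
    (fun i => ⟨2 * i.1 + 4, by have := i.isLt; omega⟩) (fun _ => rfl) (fun _ => rfl)
  rw [swapSkew, Equiv.Perm.mul_apply, Equiv.Perm.mul_apply, swap_apply_val, h, swap_apply_val]
  have hx := x.isLt
  dsimp only
  split_ifs <;> first | contradiction | omega

lemma swapOdd_mul_self : swapOdd k * swapOdd k = 1 := by
  ext x
  rw [Equiv.Perm.mul_apply, swapOdd_apply_val, swapOdd_apply_val, Equiv.Perm.one_apply]
  split_ifs <;> first | contradiction | omega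

lemma swapEven_mul_self : swapEven k * swapEven k = 1 := by
  ext x
  rw [Equiv.Perm.mul_apply, swapEven_apply_val, swapEven_apply_val, Equiv.Perm.one_apply]
  split_ifs <;> first | contradiction | omega

lemma swapEven_mul_swapOdd_mul_swapEven (hk : 2 ≤ k) :
    swapEven k * swapOdd k * swapEven k = swapSkew k hk := by
  ext x
  rw [Equiv.Perm.mul_apply, Equiv.Perm.mul_apply, swapEven_apply_val, swapOdd_apply_val,
    swapEven_apply_val, swapSkew_apply_val]
  split_ifs <;> first | contradiction | omega

lemma swapSkew_mul_self (hk : 2 ≤ k) : swapSkew k hk * swapSkew k hk = 1 := by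
  rw [← swapEven_mul_swapOdd_mul_swapEven]
  simp only [mul_assoc]
  rw [← mul_assoc (swapEven k) (swapEven k), swapEven_mul_self, one_mul,
    ← mul_assoc (swapOdd k) (swapOdd k), swapOdd_mul_self, one_mul, swapEven_mul_self]

lemma swapOdd_mul_swapSkew_pow_apply_zero (hk : 2 ≤ k) {n : ℕ} (hn : 0 < n)
    (hnk : 2 * n ≤ k) :
    (((swapOdd k * swapSkew k hk) ^ n) ⟨0, by omega⟩).val = 4 * n - 1 := by
  induction n with
  | zero => omega
  | succ n ih =>
    rw [pow_succ', Equiv.Perm.mul_apply, Equiv.Perm.mul_apply, swapOdd_apply_val,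
      swapSkew_apply_val]
    rcases Nat.eq_zero_or_pos n with rfl | h
    · simp
    · rw [ih h (by omega)]
      split_ifs <;> first | contradiction | omega

lemma swapOdd_mul_swapSkew_pow_ne_one (hk : 2 ≤ k)
    (h : (swapOdd k * swapSkew k hk) ^ k = 1) {n : ℕ} (hn : 0 < n) (hnk : n < k) :
    (swapOdd k * swapSkew k hk) ^ n ≠ 1 := by
  have key : ∀ j, 0 < j → 2 * j ≤ k → (swapOdd k * swapSkew k hk) ^ j ≠ 1 := by
    intro j hj hjk h₁
    have h₀ := swapOdd_mul_swapSkew_pow_apply_zero hk hj hjk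
    rw [h₁, Equiv.Perm.one_apply] at h₀
    simp only at h₀
    omega
  rcases le_total (2 * n) k with h₁ | h₁
  · exact key n hn h₁
  · intro h₂
    refine key (k - n) (by omega) (by omega) ?_
    rwa [← pow_sub_mul_pow _ hnk.le, h₂, mul_one] at h

lemma braidToPerm_oddRow :
    braidToPerm (2 * k) (stepTwoProd (braidSeq (2 * k)) 0 k) = swapOdd k := by
  rw [stepTwoProd_braidSeq (by omega), map_list_prod, List.map_map]
  simp only [Function.comp_def, braidToPerm_σ, braidGen, zero_add]
  rfl

lemma braidToPerm_evenRow (hk : 0 < k) :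
    braidToPerm (2 * k) (stepTwoProd (braidSeq (2 * k)) 1 (k - 1)) = swapEven k := by
  rw [stepTwoProd_braidSeq (by omega), map_list_prod, List.map_map]
  simp only [Function.comp_def, braidToPerm_σ, braidGen]
  rfl

end Permutations

/-- The products of the odd and of the even braid generators satisfy the Artin relation of
length `2 * k` in the braid group on `2 * k` strands. -/
lemma altProd_braid_rows_comm {k : ℕ} (hk : 0 < k) :
    altProd (stepTwoProd (braidSeq (2 * k)) 0 k) (stepTwoProd (braidSeq (2 * k)) 1 (k - 1))
        (2 * k) =
      altProd (stepTwoProd (braidSeq (2 * k)) 1 (k - 1)) (stepTwoProd (braidSeq (2 * k)) 0 k)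
        (2 * k) := by
  have hg := isBraidSeq_braidSeq (2 * k)
  have h := hg.altProd_rows_comm (l := 0) (N := 2 * k - 1) (by omega)
  rwa [hg.stepTwoProd_congr (l := 0) (t := k) (by omega) (by omega),
    hg.stepTwoProd_congr (l := 0 + 1) (t := k - 1) (by omega) (by omega),
    Nat.sub_add_cancel (by omega)] at h

/-- Let `k ≥ 2` be even. There exist a homomorphism `f` from the Artin
group of type `I₂(k)` to the braid group on `2k` strands with
`f s₁ = σ₁ σ₃ ⋯ σ_{2k-1}`, and an injective homomorphism `e` from the dihedral group of
order `2k` into `S_{2k}` with `e s₁ = (1 2)(3 4)⋯(2k-1, 2k)` and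
`e s₂ = (1 3)(2 5)(4 7)⋯(2k-4, 2k-1)(2k-2, 2k)` (all permutations written here
`0`-indexed on `Fin (2k)`), such that `π_{2k} ∘ f = e ∘ π_S`. -/
theorem I2_even_braid_representation (k : ℕ) (hk : 2 ≤ k) (hkeven : k % 2 = 0) :
    ∃ (f : ArtinI2 k →* BraidGroup (2 * k))
      (e : DihedralGroup k →* Equiv.Perm (Fin (2 * k))),
      f I2s₁ = ((List.finRange k).map fun i =>
          σ (m := 2 * k) ⟨2 * i.1, by have := i.isLt; omega⟩).prod ∧
      Function.Injective e ∧
      e (DihedralGroup.sr 0) = ((List.finRange k).map fun i =>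
          Equiv.swap (⟨2 * i.1, by have := i.isLt; omega⟩ : Fin (2 * k))
            ⟨2 * i.1 + 1, by have := i.isLt; omega⟩).prod ∧
      e (DihedralGroup.sr 1) =
        Equiv.swap (⟨0, by omega⟩ : Fin (2 * k)) ⟨2, by omega⟩ *
        ((List.finRange (k - 2)).map fun i =>
          Equiv.swap (⟨2 * i.1 + 1, by have := i.isLt; omega⟩ : Fin (2 * k))
            ⟨2 * i.1 + 4, by have := i.isLt; omega⟩).prod *
        Equiv.swap (⟨2 * k - 3, by omega⟩ : Fin (2 * k)) ⟨2 * k - 1, by omega⟩ ∧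
      ∀ x : ArtinI2 k, braidToPerm (2 * k) (f x) = e (artinI2ToDihedral k x) := by
  have : NeZero k := ⟨by omega⟩
  set a := stepTwoProd (braidSeq (2 * k)) 0 k with ha
  set c := stepTwoProd (braidSeq (2 * k)) 1 (k - 1) with hc
  have hrel : altProd a (c * a * c) k = altProd (c * a * c) a k :=
    altProd_mul_mul_comm hkeven (altProd_braid_rows_comm (by omega))
  have hπa : braidToPerm (2 * k) a = swapOdd k := braidToPerm_oddRow
  have hπb : braidToPerm (2 * k) (c * a * c) = swapSkew k hk := by
    rw [map_mul, map_mul, hπa, hc, braidToPerm_evenRow (by omega), swapEven_mul_swapOdd_mul_swapEven]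
  have hpow : (swapOdd k * swapSkew k hk) ^ k = 1 := by
    have h := congrArg (braidToPerm (2 * k)) hrel
    rw [map_altProd, map_altProd, hπa, hπb] at h
    exact mul_pow_eq_one_of_altProd_comm swapOdd_mul_self (swapSkew_mul_self hk) hkeven h
  let f : ArtinI2 k →* BraidGroup (2 * k) :=
    PresentedGroup.toGroup (f := ![a, c * a * c]) (by
      rintro r rfl
      rw [map_mul, map_inv, mul_inv_eq_one, map_altProd, map_altProd]
      simpa using hrel)
  let e : DihedralGroup k →* Equiv.Perm (Fin (2 * k)) :=
    dihedralLift (swapOdd k) (swapSkew k hk) swapOdd_mul_self (swapSkew_mul_self hk) hpow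
  have hf₀ : f (PresentedGroup.of 0) = a := PresentedGroup.toGroup.of _
  have hf₁ : f (PresentedGroup.of 1) = c * a * c := PresentedGroup.toGroup.of _
  have he₀ : e (.sr 0) = swapOdd k := dihedralLift_sr_zero
  have he₁ : e (.sr 1) = swapSkew k hk := dihedralLift_sr_one
  refine ⟨f, e, ?_, ?_, he₀, he₁, ?_⟩
  · rw [I2s₁, hf₀, ha, stepTwoProd_braidSeq (by omega)]
    simp only [zero_add]
  · refine DihedralGroup.injective_of_ne_one e (fun h => ?_) (fun h => ?_) fun n hn hnk => ?_
    · have h₀ := swapOdd_apply_val (k := k) ⟨0, by omega⟩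
      rw [← he₀, h] at h₀
      simp at h₀
    · have h₀ := swapSkew_apply_val hk ⟨0, by omega⟩
      rw [← he₁, h] at h₀
      simp at h₀
    · exact (dihedralLift_r_natCast n).trans_ne (swapOdd_mul_swapSkew_pow_ne_one hk hpow hn hnk)
  · have hcomp : (braidToPerm (2 * k)).comp f = e.comp (artinI2ToDihedral k) := by
      refine PresentedGroup.ext fun i => ?_
      have hπ : artinI2ToDihedral k (PresentedGroup.of i) = ![.sr 0, .sr 1] i :=
        PresentedGroup.toGroup.of _
      rw [MonoidHom.comp_apply, MonoidHom.comp_apply, hπ]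
      fin_cases i
      · exact (congrArg _ hf₀).trans (hπa.trans he₀.symm)
      · exact (congrArg _ hf₁).trans (hπb.trans he₁.symm)
    exact DFunLike.congr_fun hcomp
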